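/- arXiv:1502.04690 — 2 statements merged into one kernel-verified Lean document; each statement's English description precedes it below -/
import Mathlib

section
/- Let G be a strongly connected finite directed multigraph on vertex set V, let s ∈ V, and let σ, τ ∈ ℤ^V with |σ| = |τ|. Then σ ≡ τ (mod Δℤ^V) if and only if σ̃ ≡ τ̃ (mod Δ_s ℤ^{V∖{s}} + ℤβ_s), where σ̃, τ̃ denote the restrictions of σ, τ to V∖{s}. -/
open Finset

variable {V : Type} [Fintype V] [DecidableEq V]

/-- Outdegree of `v`. -/
def outdeg (d : V → V → ℕ) (v : V) : ℕ := ∑ w, d v w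

/-- Indegree of `v`. -/
def indeg (d : V → V → ℕ) (v : V) : ℕ := ∑ w, d w v

/-- The graph Laplacian. -/
def lap (d : V → V → ℕ) : Matrix V V ℤ :=
  Matrix.of fun v w => if v = w then (outdeg d v : ℤ) - d v v else -(d w v : ℤ)

/-- Strong connectivity. -/
def StronglyConnected (d : V → V → ℕ) : Prop :=
  ∀ u v : V, Relation.ReflTransGen (fun a b => 1 ≤ d a b) u v

/-- Eulerian: every vertex has indegree equal to outdegree. -/
def Eulerian (d : V → V → ℕ) : Prop := ∀ v, indeg d v = outdeg d v

/-- Reduced Laplacian with the row and column of `s` deleted. -/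
def redLap (d : V → V → ℕ) (s : V) : Matrix {v : V // v ≠ s} {v : V // v ≠ s} ℤ :=
  Matrix.of fun v w => lap d v.1 w.1

/-- Number of oriented spanning trees rooted at `s` (matrix-tree theorem). -/
def kappa (d : V → V → ℕ) (s : V) : ℤ := (redLap d s).det

/-- Pham index. -/
def phamIndex (d : V → V → ℕ) : ℤ := Finset.univ.gcd (kappa d)

/-- Integer column span of the Laplacian. -/
def lapLattice (d : V → V → ℕ) : Submodule ℤ (V → ℤ) :=
  LinearMap.range (lap d).mulVecLin

/-- Integer column span of the reduced Laplacian. -/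
def redLattice (d : V → V → ℕ) (s : V) : Submodule ℤ ({v : V // v ≠ s} → ℤ) :=
  LinearMap.range (redLap d s).mulVecLin

/-- Integer vectors with coordinate sum zero. -/
def zeroSum (V : Type) [Fintype V] : Submodule ℤ (V → ℤ) where
  carrier := {f | ∑ v, f v = 0}
  add_mem' := by
    intro a b ha hb
    simp only [Set.mem_setOf_eq] at *
    simp [Finset.sum_add_distrib, ha, hb]
  zero_mem' := by simp
  smul_mem' := by
    intro c f hf
    simp only [Set.mem_setOf_eq, Pi.smul_apply, smul_eq_mul] at *
    simp [← Finset.mul_sum, hf]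

/-- The sandpile `β_s`, recording edge multiplicities out of `s`. -/
def betaS (d : V → V → ℕ) (s : V) : {v : V // v ≠ s} → ℤ := fun v => (d s v.1 : ℤ)

/-- Stable chip configuration. -/
def Stable (d : V → V → ℕ) (σ : V → ℤ) : Prop := ∀ v, σ v < (outdeg d v : ℤ)

/-- Result of firing vertex `v`. -/
def fire (d : V → V → ℕ) (σ : V → ℤ) (v : V) : V → ℤ := fun w => σ w - lap d w v

/-- One legal firing step. -/
def LegalStep (d : V → V → ℕ) (σ τ : V → ℤ) : Prop :=
  ∃ v, (outdeg d v : ℤ) ≤ σ v ∧ τ = fire d σ v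

/-- `σ` stabilizes if some legal firing sequence from `σ` ends in a stable configuration. -/
def Stabilizes (d : V → V → ℕ) (σ : V → ℤ) : Prop :=
  ∃ τ, Relation.ReflTransGen (LegalStep d) σ τ ∧ Stable d τ

/-- Legal firing sequences, recorded as lists of fired vertices. -/
inductive LegalSeq (d : V → V → ℕ) : (V → ℤ) → List V → Prop
  | nil (σ : V → ℤ) : LegalSeq d σ []
  | cons (σ : V → ℤ) (v : V) (l : List V) :
      (outdeg d v : ℤ) ≤ σ v → LegalSeq d (fire d σ v) l → LegalSeq d σ (v :: l)

/-- Period vector. -/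
def IsPeriodVec (d : V → V → ℕ) (p : V → ℕ) : Prop :=
  p ≠ 0 ∧ (lap d).mulVec (fun v => (p v : ℤ)) = 0

/-- Simple directed path from `x` to `y`, as a list of distinct vertices. -/
def IsSimplePath (d : V → V → ℕ) (x y : V) (p : List V) : Prop :=
  p.Nodup ∧ p.head? = some x ∧ p.getLast? = some y ∧ p.Chain' (fun a b => 1 ≤ d a b)

theorem lap_diag (d : V → V → ℕ) (v : V) : lap d v v = (outdeg d v : ℤ) - d v v := by
  simp [lap]

theorem lap_of_ne (d : V → V → ℕ) {v w : V} (hvw : v ≠ w) : lap d v w = -(d w v : ℤ) := by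
  simp [lap, hvw]

/-- The columns of the Laplacian sum to zero. -/
theorem sum_lap (d : V → V → ℕ) (w : V) : ∑ v, lap d v w = 0 := by
  have hterm : ∀ v, lap d v w = (if v = w then (outdeg d w : ℤ) else 0) - d w v := by
    intro v
    by_cases hv : v = w
    · subst hv
      simp [lap_diag]
    · simp [lap_of_ne d hv, hv]
  simp [hterm, Finset.sum_sub_distrib, outdeg]

theorem sum_lap_mulVec (d : V → V → ℕ) (y : V → ℤ) : ∑ v, (lap d).mulVec y v = 0 := by
  simp only [Matrix.mulVec, dotProduct]
  rw [Finset.sum_comm]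
  simp [← Finset.sum_mul, sum_lap]

theorem sum_eq_add_sum_ne (s : V) (f : V → ℤ) :
    ∑ v, f v = f s + ∑ v : {v : V // v ≠ s}, f v.1 :=
  Fintype.sum_eq_add_sum_subtype_ne f s

/-- Away from `s`, the Laplacian acts as the reduced Laplacian minus a multiple of `betaS`. -/
theorem lap_mulVec_of_ne (d : V → V → ℕ) (s : V) (y : V → ℤ) (v : {v : V // v ≠ s}) :
    (lap d).mulVec y v.1 =
      ((redLap d s).mulVec (fun w => y w.1) + (-y s) • betaS d s) v := by
  simp only [Matrix.mulVec, dotProduct, Pi.add_apply, Pi.smul_apply, smul_eq_mul, betaS]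
  rw [sum_eq_add_sum_ne s, lap_of_ne d v.2]
  simp only [redLap, Matrix.of_apply]
  ring

/-- Integer vectors with equal sums that agree away from `s` are equal. -/
theorem eq_of_sum_eq_of_eq_ne (s : V) {f g : V → ℤ} (hsum : ∑ v, f v = ∑ v, g v)
    (hne : ∀ v : {v : V // v ≠ s}, f v.1 = g v.1) : f = g := by
  rw [sum_eq_add_sum_ne s f, sum_eq_add_sum_ne s g, Finset.sum_congr rfl fun v _ => hne v] at hsum
  funext v
  by_cases hv : v = s
  · subst hv
    exact add_right_cancel hsum
  · exact hne ⟨v, hv⟩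

theorem stmt13 (d : V → V → ℕ) (h : StronglyConnected d) (s : V) (σ τ : V → ℤ)
    (hsum : ∑ v, σ v = ∑ v, τ v) :
    σ - τ ∈ lapLattice d ↔
      ∃ (x : {v : V // v ≠ s} → ℤ) (k : ℤ),
        (fun v : {v : V // v ≠ s} => σ v.1 - τ v.1) = (redLap d s).mulVec x + k • betaS d s := by
  constructor
  · rintro ⟨y, hy⟩
    refine ⟨fun w => y w.1, -y s, funext fun v => ?_⟩
    rw [← lap_mulVec_of_ne]
    exact (congrFun hy v.1).symm
  · rintro ⟨x, k, hx⟩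
    refine ⟨fun v => if hv : v = s then -k else x ⟨v, hv⟩, ?_⟩
    rw [Matrix.mulVecLin_apply]
    refine eq_of_sum_eq_of_eq_ne s ?_ fun v => ?_
    · simp [sum_lap_mulVec, Finset.sum_sub_distrib, hsum]
    · have hrest : (fun w : {v : V // v ≠ s} => if hw : w.1 = s then -k else x ⟨w.1, hw⟩) = x :=
        funext fun w => dif_neg w.2
      rw [lap_mulVec_of_ne, hrest, dif_pos rfl, neg_neg, ← hx, Pi.sub_apply]
end

section
/- Let G be a strongly connected finite directed multigraph on vertex set V and let σ ∈ ℕ^V be a nonnegative chip configuration that stabilizes. Suppose σ = σ_0, …, σ_k is a legal firing sequence ending in a stable configuration, and let x ∈ ℕ^V record the number of times each vertex fires in this sequence. Then x(v) ≤ D² for every v ∈ V, where D = ∏_{w∈V} d_w is the product of all outdegrees. -/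
open Finset

variable {V : Type} [Fintype V] [DecidableEq V]

lemma lap_mulVec_apply (d : V → V → ℕ) (y : V → ℤ) (v : V) :
    (lap d).mulVec y v = outdeg d v * y v - ∑ u, (d u v : ℤ) * y u := by
  have key : ∀ u, lap d v u * y u =
      (if v = u then (outdeg d v : ℤ) * y u else 0) - (d u v : ℤ) * y u := by
    intro u
    by_cases huv : v = u
    · subst huv
      simp [lap, sub_mul]
    · simp [lap, huv]
  simp only [Matrix.mulVec, dotProduct, key, Finset.sum_sub_distrib]
  simp

lemma fire_eq (d : V → V → ℕ) (σ : V → ℤ) (v : V) :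
    fire d σ v = σ - (lap d).mulVec (Pi.single v 1) := by
  ext w
  simp [fire]

lemma foldl_fire (d : V → V → ℕ) (σ : V → ℤ) (l : List V) :
    l.foldl (fire d) σ = σ - (lap d).mulVec (fun v => (l.count v : ℤ)) := by
  induction l generalizing σ with
  | nil =>
    have : (fun _ : V => (0 : ℤ)) = 0 := rfl
    simp [this]
  | cons v l ih =>
    have hcount : (fun w => ((v :: l).count w : ℤ)) =
        Pi.single v 1 + fun w => (l.count w : ℤ) := by
      ext w
      rcases eq_or_ne v w with rfl | hvw
      · simp [add_comm]
      · simp [List.count_cons_of_ne hvw, hvw.symm]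
    rw [List.foldl_cons, ih, fire_eq, hcount, Matrix.mulVec_add]
    abel

lemma LegalSeq.foldl_nonneg {d : V → V → ℕ} {σ : V → ℤ} {l : List V} (hl : LegalSeq d σ l)
    (hσ : ∀ v, 0 ≤ σ v) : ∀ v, 0 ≤ l.foldl (fire d) σ v := by
  induction hl with
  | nil σ => simpa using hσ
  | cons σ v l hv _ ih =>
    refine ih fun w => ?_
    have := hσ w
    simp only [fire, lap, Matrix.of_apply]
    split_ifs with hwv
    · subst hwv
      omega
    · omega

/-- The least action principle: a legal firing sequence fires no vertex more often than any
nonnegative vector whose firing stabilizes the configuration. -/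
lemma LegalSeq.count_le {d : V → V → ℕ} {σ : V → ℤ} {l : List V} (hl : LegalSeq d σ l)
    (y : V → ℤ) (hy : 0 ≤ y) (hstable : Stable d (σ - (lap d).mulVec y)) (w : V) :
    (l.count w : ℤ) ≤ y w := by
  induction hl generalizing y w with
  | nil σ => simpa using hy w
  | cons σ v l hv _ ih =>
    have hpos : 1 ≤ y v := by
      by_contra! hlt
      have hyv : y v = 0 := le_antisymm (by omega) (hy v)
      have h1 := hstable v
      rw [Pi.sub_apply, lap_mulVec_apply, hyv] at h1
      have h2 : 0 ≤ ∑ u, (d u v : ℤ) * y u :=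
        Finset.sum_nonneg fun u _ => mul_nonneg (by positivity) (hy u)
      linarith
    have hsub : 0 ≤ y - Pi.single v 1 := by
      intro u
      rcases eq_or_ne u v with rfl | huv
      · simpa using hpos
      · simpa [huv] using hy u
    have h := ih (y - Pi.single v 1) hsub (by
      rw [fire_eq, Matrix.mulVec_sub]
      convert hstable using 1
      abel) w
    rcases eq_or_ne v w with rfl | hvw
    · simp at h ⊢
      linarith
    · simpa [List.count_cons_of_ne hvw, hvw.symm] using h

/-- A set of vertices that grows along edges from `s` backwards exhausts a strongly connected
graph. -/
lemma StronglyConnected.induction {d : V → V → ℕ} (h : StronglyConnected d) (s : V)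
    (P : Finset V → Prop) (base : P {s})
    (step : ∀ S : Finset V, P S → ∀ u ∉ S, ∀ v ∈ S, 1 ≤ d u v → P (insert u S)) :
    P univ := by
  classical
  obtain ⟨S, hS, hmax⟩ := Finset.exists_max_image
    (univ.filter fun S : Finset V => s ∈ S ∧ P S) Finset.card ⟨{s}, by simp [base]⟩
  simp only [Finset.mem_filter, Finset.mem_univ, true_and] at hS hmax
  suffices S = univ by rw [← this]; exact hS.2
  refine Finset.eq_univ_iff_forall.2 fun w => ?_
  refine Relation.ReflTransGen.head_induction_on (h w s) hS.1 fun {u v} huv _ hv => ?_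
  by_contra hu
  have := hmax (insert u S) ⟨by simp [hS.1], step S hS.2 u hu v hv huv⟩
  rw [Finset.card_insert_of_notMem hu] at this
  omega

/-- Every vertex reaches `v` under iteration of `g`. -/
def AllReach {α : Type*} (g : α → α) (v : α) : Prop := ∀ w, ∃ k, g^[k] w = v

lemma AllReach.update {α : Type*} [DecidableEq α] {g : α → α} {v : α} (hg : AllReach g v) (z : α) :
    AllReach (Function.update g v z) v := by
  have key : ∀ k w, g^[k] w = v → ∃ j, (Function.update g v z)^[j] w = v := by
    intro k
    induction k with
    | zero => exact fun w hw => ⟨0, hw⟩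
    | succ k ih =>
      intro w hw
      rcases eq_or_ne w v with rfl | hwv
      · exact ⟨0, rfl⟩
      · obtain ⟨j, hj⟩ := ih (g w) hw
        exact ⟨j + 1, by rwa [Function.iterate_succ_apply, Function.update_of_ne hwv]⟩
  exact fun w => (hg w).elim fun k hk => key k w hk

lemma AllReach.apply {α : Type*} {g : α → α} {u : α} (hg : AllReach g u) : AllReach g (g u) :=
  fun w => (hg w).elim fun k hk => ⟨k + 1, by rw [Function.iterate_succ_apply', hk]⟩

lemma AllReach.mem_periodicPts {α : Type*} {g : α → α} {u : α} (hg : AllReach g u) :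
    u ∈ Function.periodicPts g := by
  obtain ⟨k, hk⟩ := hg (g u)
  exact ⟨k + 1, k.succ_pos, hk⟩

lemma AllReach.existsUnique_preimage {α : Type*} {g : α → α} {v : α} (hg : AllReach g v) :
    ∃! u, AllReach g u ∧ g u = v := by
  obtain ⟨k, hk⟩ := hg (g v)
  have hreach : AllReach g (g^[k] v) := fun w =>
    (hg w).elim fun j hj => ⟨k + j, by rw [Function.iterate_add_apply, hj]⟩
  have happly : g (g^[k] v) = v := by
    rw [← Function.iterate_succ_apply' g, Function.iterate_succ_apply, hk]
  refine ⟨g^[k] v, ⟨hreach, happly⟩, fun u hu => ?_⟩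
  exact (Function.bijOn_periodicPts g).injOn hu.1.mem_periodicPts hreach.mem_periodicPts
    (hu.2.trans happly.symm)

open Classical in
/-- The number of spanning trees of the multigraph oriented towards `v`. -/
noncomputable def treeCount (d : V → V → ℕ) (v : V) : ℕ :=
  ∑ g : V → V with AllReach g v ∧ g v = v, ∏ w ∈ univ.erase v, d w (g w)

open Classical in
lemma treeCount_mul (d : V → V → ℕ) (u z : V) :
    treeCount d u * d u z =
      ∑ g : V → V with AllReach g u ∧ g u = z, ∏ w, d w (g w) := by
  rw [treeCount, Finset.sum_mul]
  refine Finset.sum_nbij' (fun g => Function.update g u z) (fun g => Function.update g u u)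
    ?_ ?_ ?_ ?_ ?_
  · intro g hg
    simp only [Finset.mem_filter, Finset.mem_univ, true_and] at hg ⊢
    exact ⟨hg.1.update z, by simp⟩
  · intro g hg
    simp only [Finset.mem_filter, Finset.mem_univ, true_and] at hg ⊢
    exact ⟨hg.1.update u, by simp⟩
  · intro g hg
    simp only [Finset.mem_filter, Finset.mem_univ, true_and] at hg
    simp [hg.2]
  · intro g hg
    simp only [Finset.mem_filter, Finset.mem_univ, true_and] at hg
    simp [← hg.2]
  · intro g _
    rw [← Finset.prod_erase_mul univ _ (Finset.mem_univ u), Function.update_self]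
    congr 1
    refine Finset.prod_congr rfl fun w hw => ?_
    rw [Function.update_of_ne (Finset.ne_of_mem_erase hw)]

open Classical in
lemma treeCount_mul_outdeg (d : V → V → ℕ) (v : V) :
    treeCount d v * outdeg d v = ∑ g : V → V with AllReach g v, ∏ w, d w (g w) := by
  rw [outdeg, Finset.mul_sum, ← Finset.sum_fiberwise _ (fun g : V → V => g v)]
  refine Finset.sum_congr rfl fun z _ => ?_
  rw [treeCount_mul, Finset.filter_filter]

/-- The Markov chain tree theorem: spanning tree counts are balanced at every vertex. -/
lemma sum_treeCount_mul (d : V → V → ℕ) (v : V) :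
    ∑ u, treeCount d u * d u v = treeCount d v * outdeg d v := by
  classical
  rw [treeCount_mul_outdeg]
  simp only [treeCount_mul, Finset.sum_filter]
  rw [Finset.sum_comm]
  refine Finset.sum_congr rfl fun g _ => ?_
  split_ifs with hg
  · obtain ⟨u, hu, huniq⟩ := AllReach.existsUnique_preimage hg
    rw [Finset.sum_eq_single u, if_pos hu]
    · exact fun b _ hb => if_neg fun hb' => hb (huniq b hb')
    · simp
  · refine Finset.sum_eq_zero fun u _ => if_neg ?_
    rintro ⟨hu, rfl⟩
    exact hg hu.apply

lemma lap_mulVec_treeCount (d : V → V → ℕ) :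
    (lap d).mulVec (fun v => (treeCount d v : ℤ)) = 0 := by
  ext v
  have h := sum_treeCount_mul d v
  zify at h
  rw [lap_mulVec_apply, Pi.zero_apply, sub_eq_zero, mul_comm, ← h]
  exact Finset.sum_congr rfl fun u _ => mul_comm _ _

lemma treeCount_le (d : V → V → ℕ) (v : V) (hv : 1 ≤ outdeg d v) :
    treeCount d v ≤ ∏ w, outdeg d w := by
  classical
  calc treeCount d v ≤ treeCount d v * outdeg d v := Nat.le_mul_of_pos_right _ hv
    _ = ∑ g : V → V with AllReach g v, ∏ w, d w (g w) := treeCount_mul_outdeg d v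
    _ ≤ ∑ g : V → V, ∏ w, d w (g w) :=
      Finset.sum_le_sum_of_subset (Finset.filter_subset _ _)
    _ = ∏ w, outdeg d w := by
      simp only [outdeg, Finset.prod_univ_sum, Fintype.piFinset_univ]

lemma StronglyConnected.treeCount_pos {d : V → V → ℕ} (h : StronglyConnected d) (s : V) :
    0 < treeCount d s := by
  classical
  have key : ∃ g : V → V, ∀ w ∈ (univ : Finset V), (w = s ∨ 1 ≤ d w (g w)) ∧
      Relation.ReflTransGen (fun a b => a ∈ (univ : Finset V) ∧ g a = b) w s := by
    refine h.induction s (fun S => ∃ g : V → V, ∀ w ∈ S,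
      (w = s ∨ 1 ≤ d w (g w)) ∧ Relation.ReflTransGen (fun a b => a ∈ S ∧ g a = b) w s) ?_ ?_
    · refine ⟨id, fun w hw => ?_⟩
      rw [Finset.mem_singleton.1 hw]
      exact ⟨Or.inl rfl, .refl⟩
    · rintro S ⟨g, hg⟩ u hu v hv huv
      have lift : ∀ w ∈ S, Relation.ReflTransGen
          (fun a b => a ∈ insert u S ∧ Function.update g u v a = b) w s := fun w hw =>
        Relation.ReflTransGen.mono (fun a b hab => ⟨Finset.mem_insert_of_mem hab.1, by
          rw [Function.update_of_ne (ne_of_mem_of_not_mem hab.1 hu)]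
          exact hab.2⟩) _ _ (hg w hw).2
      refine ⟨Function.update g u v, fun w hw => ?_⟩
      rcases Finset.mem_insert.1 hw with rfl | hwS
      · exact ⟨Or.inr (by simpa using huv), .head ⟨hw, by simp⟩ (lift v hv)⟩
      · rw [Function.update_of_ne (ne_of_mem_of_not_mem hwS hu)]
        exact ⟨(hg w hwS).1, lift w hwS⟩
  obtain ⟨g, hg⟩ := key
  have hreach : AllReach g s := fun w => by
    refine Relation.ReflTransGen.head_induction_on (hg w (Finset.mem_univ w)).2 ⟨0, rfl⟩ ?_
    rintro a b ⟨-, rfl⟩ - ⟨k, hk⟩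
    exact ⟨k + 1, hk⟩
  have hpos : 0 < ∏ w ∈ univ.erase s, d w (Function.update g s s w) := by
    refine Finset.prod_pos fun w hw => ?_
    have hws := Finset.ne_of_mem_erase hw
    rw [Function.update_of_ne hws]
    exact (hg w (Finset.mem_univ w)).1.resolve_left hws
  refine hpos.trans_le ?_
  exact Finset.single_le_sum (f := fun g : V → V => ∏ w ∈ univ.erase s, d w (g w))
    (fun _ _ => Nat.zero_le _) (by simp [hreach.update s])

/-- If each edge `u → v` forces `f u ≤ f v * outdeg d v`, then `f` varies by at most a factor
`∏ w, outdeg d w`. -/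
lemma StronglyConnected.le_mul_prod_outdeg {d : V → V → ℕ} (h : StronglyConnected d)
    (hd : ∀ v, 1 ≤ outdeg d v) (f : V → ℕ)
    (hf : ∀ u v, 1 ≤ d u v → f u ≤ f v * outdeg d v) (s u : V) :
    f u ≤ f s * ∏ w, outdeg d w := by
  have key : ∀ u ∈ (univ : Finset V), f u * outdeg d u ≤ f s * ∏ w, outdeg d w := by
    refine h.induction s
      (fun S => ∀ u ∈ S, f u * outdeg d u ≤ f s * ∏ w ∈ S, outdeg d w) (by simp) ?_
    intro S hS u hu v hv huv w hw
    rw [Finset.prod_insert hu, mul_left_comm]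
    rcases Finset.mem_insert.1 hw with rfl | hwS
    · rw [mul_comm]
      exact Nat.mul_le_mul_left _ ((hf w v huv).trans (hS v hv))
    · exact (hS w hwS).trans (Nat.le_mul_of_pos_left _ (hd u))
  exact (Nat.le_mul_of_pos_right _ (hd u)).trans (key u (Finset.mem_univ u))

lemma count_succ_le {d : V → V → ℕ} {σ : V → ℤ} (hσ : ∀ v, 0 ≤ σ v) {l : List V}
    (hstable : Stable d (l.foldl (fire d) σ)) (u v : V) (huv : 1 ≤ d u v) :
    l.count u + 1 ≤ (l.count v + 1) * outdeg d v := by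
  have h1 := hstable v
  rw [foldl_fire, Pi.sub_apply, lap_mulVec_apply] at h1
  have h2 : (d u v : ℤ) * l.count u ≤ ∑ w, (d w v : ℤ) * l.count w :=
    Finset.single_le_sum (f := fun w => (d w v : ℤ) * l.count w)
      (fun w _ => by positivity) (Finset.mem_univ u)
  have h3 : (l.count u : ℤ) ≤ d u v * l.count u :=
    le_mul_of_one_le_left (by positivity) (by exact_mod_cast huv)
  have h4 := hσ v
  zify
  linarith

/-- In a stabilizing legal firing sequence some vertex fires less often than its tree count. -/
lemma exists_count_lt_treeCount {d : V → V → ℕ} (h : StronglyConnected d) {σ : V → ℤ}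
    {l : List V} (hl : LegalSeq d σ l) (hstable : Stable d (l.foldl (fire d) σ)) (v : V) :
    ∃ s, l.count s < treeCount d s := by
  by_contra! hle
  have hcount := hl.count_le
    ((fun w => (l.count w : ℤ)) - fun w => (treeCount d w : ℤ))
    (fun w => by simpa using hle w)
    (by rwa [Matrix.mulVec_sub, lap_mulVec_treeCount, sub_zero, ← foldl_fire]) v
  have hpos := h.treeCount_pos v
  simp only [Pi.sub_apply] at hcount
  omega

theorem stmt17 (d : V → V → ℕ) (h : StronglyConnected d) (σ : V → ℤ) (hσ : ∀ v, 0 ≤ σ v)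
    (l : List V) (hl : LegalSeq d σ l) (hstable : Stable d (List.foldl (fire d) σ l)) :
    ∀ v, l.count v ≤ (∏ w, outdeg d w) ^ 2 := by
  intro v
  have hd : ∀ v, 1 ≤ outdeg d v := fun v => by
    have h1 := hstable v
    have h2 := hl.foldl_nonneg hσ v
    omega
  obtain ⟨s, hs⟩ := exists_count_lt_treeCount h hl hstable v
  calc l.count v ≤ l.count v + 1 := Nat.le_succ _
    _ ≤ (l.count s + 1) * ∏ w, outdeg d w :=
      h.le_mul_prod_outdeg hd (fun w => l.count w + 1)
        (count_succ_le hσ hstable) s v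
    _ ≤ (∏ w, outdeg d w) * ∏ w, outdeg d w :=
      Nat.mul_le_mul_right _ (hs.trans_le (treeCount_le d s (hd s)))
    _ = (∏ w, outdeg d w) ^ 2 := (sq _).symm
end
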